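/- There exists ε₀ > 0 depending only on C, p, K such that: if the smallness condition holds with some ε ≤ ε₀, then there exists a strictly increasing sequence of times tₙ → ∞ such that ∫_ℝ sech²(x/λ(tₙ)) (u₁² + (∂ₓu₁)² + u₂²)(tₙ,x) dx → 0 as n → ∞. -/

import Mathlib

open MeasureTheory Filter

noncomputable def sech (x : ℝ) : ℝ := 1 / Real.cosh x

noncomputable def lam (C t : ℝ) : ℝ := C * t / (Real.log t) ^ 2

/-! ### The hyperbolic weight -/

lemma sech_nonneg (y : ℝ) : 0 ≤ sech y := by
  unfold sech
  have := Real.cosh_pos y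
  positivity

lemma sech_le_one (y : ℝ) : sech y ≤ 1 := by
  unfold sech
  rw [div_le_one (Real.cosh_pos y)]
  exact Real.one_le_cosh y

lemma sech_sq_le_one (y : ℝ) : sech y ^ 2 ≤ 1 :=
  pow_le_one₀ (sech_nonneg y) (sech_le_one y)

lemma tanh_sq_eq (y : ℝ) : Real.tanh y ^ 2 = 1 - sech y ^ 2 := by
  have h := (Real.cosh_pos y).ne'
  have h2 := Real.cosh_sq y
  rw [Real.tanh_eq_sinh_div_cosh, sech]
  field_simp
  linarith

lemma abs_tanh_le_one (y : ℝ) : |Real.tanh y| ≤ 1 := by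
  rw [← sq_le_one_iff_abs_le_one, tanh_sq_eq]
  nlinarith [sq_nonneg (sech y)]

lemma abs_mul_sech_sq_le_one (y : ℝ) : |y| * sech y ^ 2 ≤ 1 := by
  have h1 : |y| ≤ Real.sinh |y| := Real.self_le_sinh_iff.2 (abs_nonneg y)
  have h2 : Real.cosh y ^ 2 = Real.sinh |y| ^ 2 + 1 := by
    rw [← Real.cosh_abs, Real.cosh_sq]
  have h3 : |y| ≤ Real.cosh y ^ 2 := by nlinarith [sq_nonneg (Real.sinh |y| - 1)]
  have h4 : 0 < Real.cosh y ^ 2 := by have := Real.cosh_pos y; positivity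
  rw [sech, div_pow, one_pow, mul_one_div, div_le_one h4]
  exact h3

lemma hasDerivAt_tanh (y : ℝ) : HasDerivAt Real.tanh (sech y ^ 2) y := by
  have h := (Real.cosh_pos y).ne'
  have h2 := Real.cosh_sq y
  have h1 := (Real.hasDerivAt_sinh y).div (Real.hasDerivAt_cosh y) h
  have h3 : Real.tanh = Real.sinh / Real.cosh := by
    funext z; exact Real.tanh_eq_sinh_div_cosh z
  rw [h3]
  refine h1.congr_deriv ?_
  simp only [sech]
  field_simp
  linarith

lemma hasDerivAt_sech_sq (y : ℝ) :
    HasDerivAt (fun y => sech y ^ 2) (-2 * Real.tanh y * sech y ^ 2) y := by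
  have h1 : (fun y => sech y ^ 2) = fun y => 1 - Real.tanh y ^ 2 := by
    funext z; rw [tanh_sq_eq]; ring
  rw [h1]
  refine (((hasDerivAt_tanh y).pow 2).const_sub 1).congr_deriv ?_
  push_cast
  ring

lemma continuous_tanh : Continuous Real.tanh :=
  continuous_iff_continuousAt.2 fun y => (hasDerivAt_tanh y).continuousAt

lemma continuous_sech_sq : Continuous fun y => sech y ^ 2 :=
  continuous_iff_continuousAt.2 fun y => (hasDerivAt_sech_sq y).continuousAt

/-! ### Functions with quadratic decay -/

/-- Continuous functions that are `O((1 + x ^ 2)⁻¹)` on the whole line. -/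
def QuadDecay (g : ℝ → ℝ) : Prop :=
  Continuous g ∧ ∃ M, ∀ x, |g x| ≤ M * (1 + x ^ 2)⁻¹

lemma inv_one_add_sq_le_one (x : ℝ) : (1 + x ^ 2)⁻¹ ≤ 1 :=
  inv_le_one_of_one_le₀ (by nlinarith [sq_nonneg x])

namespace QuadDecay

variable {g h : ℝ → ℝ}

lemma integrable (hg : QuadDecay g) : Integrable g := by
  obtain ⟨hc, M, hM⟩ := hg
  refine (integrable_inv_one_add_sq.const_mul M).mono' hc.aestronglyMeasurable ?_
  exact Eventually.of_forall hM

lemma bounded (hg : QuadDecay g) : ∃ B, ∀ x, |g x| ≤ B := by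
  obtain ⟨hc, M, hM⟩ := hg
  have hM0 : 0 ≤ M := by simpa using (abs_nonneg _).trans (hM 0)
  exact ⟨M, fun x => (hM x).trans (mul_le_of_le_one_right hM0 (inv_one_add_sq_le_one x))⟩

lemma bdd_mul (hg : QuadDecay g) (hh : Continuous h) {B : ℝ} (hB : ∀ x, |h x| ≤ B) :
    QuadDecay fun x => h x * g x := by
  obtain ⟨hc, M, hM⟩ := hg
  refine ⟨hh.mul hc, B * M, fun x => ?_⟩
  rw [abs_mul, mul_assoc]
  exact mul_le_mul (hB x) (hM x) (abs_nonneg _) ((abs_nonneg _).trans (hB x))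

lemma mul (hh : QuadDecay h) (hg : QuadDecay g) : QuadDecay fun x => h x * g x := by
  obtain ⟨B, hB⟩ := hh.bounded
  exact hg.bdd_mul hh.1 hB

lemma sq (hg : QuadDecay g) : QuadDecay fun x => g x ^ 2 := by
  simpa only [pow_two] using hg.mul hg

lemma add (hh : QuadDecay h) (hg : QuadDecay g) : QuadDecay fun x => h x + g x := by
  obtain ⟨hc, M, hM⟩ := hh
  obtain ⟨hc', M', hM'⟩ := hg
  refine ⟨hc.add hc', M + M', fun x => ?_⟩
  rw [add_mul]
  exact (abs_add_le _ _).trans (add_le_add (hM x) (hM' x))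

lemma const_mul (c : ℝ) (hg : QuadDecay g) : QuadDecay fun x => c * g x :=
  hg.bdd_mul continuous_const (fun _ => le_refl |c|)

lemma sub (hh : QuadDecay h) (hg : QuadDecay g) : QuadDecay fun x => h x - g x := by
  simpa [sub_eq_add_neg] using hh.add (hg.const_mul (-1))

lemma of_le (hg : QuadDecay g) (hh : Continuous h) (hle : ∀ x, |h x| ≤ |g x|) :
    QuadDecay h := by
  obtain ⟨hc, M, hM⟩ := hg
  exact ⟨hh, M, fun x => (hle x).trans (hM x)⟩

end QuadDecay

/-! ### The nonlinearity -/

lemma hasDerivAt_integral_mul_deriv {f : ℝ → ℝ} (hf : ContDiff ℝ (⊤ : ℕ∞) f) (s : ℝ) :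
    HasDerivAt (fun s => ∫ r in (0 : ℝ)..s, r * deriv f r) (s * deriv f s) s := by
  have hc : Continuous fun r => r * deriv f r :=
    continuous_id.mul (hf.continuous_deriv (by simp))
  exact intervalIntegral.integral_hasDerivAt_right (hc.intervalIntegrable _ _)
    (hc.stronglyMeasurableAtFilter _ _) hc.continuousAt

lemma abs_integral_mul_deriv_le {f : ℝ → ℝ} {s c : ℝ}
    (hf : ∀ r, |r| ≤ |s| → |deriv f r| ≤ c) :
    |∫ r in (0 : ℝ)..s, r * deriv f r| ≤ c * s ^ 2 := by
  have h : ∀ r ∈ Set.uIoc 0 s, ‖r * deriv f r‖ ≤ |s| * c := by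
    intro r hr
    have hrs : |r| ≤ |s| := by
      rcases Set.mem_uIoc.1 hr with h | h
      · rw [abs_of_pos h.1]; exact h.2.trans (le_abs_self s)
      · rw [abs_of_nonpos h.2, abs_of_neg (h.1.trans_le h.2)]; linarith
    rw [Real.norm_eq_abs, abs_mul]
    exact mul_le_mul hrs (hf r hrs) (abs_nonneg _) (abs_nonneg _)
  have := intervalIntegral.norm_integral_le_of_norm_le_const h
  rw [Real.norm_eq_abs, sub_zero] at this
  calc _ ≤ |s| * c * |s| := this
    _ = c * |s| ^ 2 := by ring
    _ = c * s ^ 2 := by rw [sq_abs]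

/-! ### The virial estimate at a fixed time -/

/-- The density of the time derivative of `∫ tanh (x / l) * a * b` along the flow, where `μ` is the
logarithmic derivative of the scale `l`. -/
noncomputable def virialDensity (f : ℝ → ℝ) (l μ : ℝ) (a a₁ a₃ b b₁ : ℝ → ℝ) (x : ℝ) : ℝ :=
  sech (x / l) ^ 2 * (-(x / l) * μ) * (a x * b x)
    + Real.tanh (x / l) * (b₁ x * b x + a x * (a₁ x - a₃ x - deriv f (a x) * a₁ x))

lemma abs_virialDensity_le {f : ℝ → ℝ} {l μ M : ℝ} {a a₁ a₃ b b₁ : ℝ → ℝ} {x : ℝ}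
    (hμ : |μ| ≤ 1) (hf : |deriv f (a x)| ≤ 1)
    (ha : |a x| ≤ M * (1 + x ^ 2)⁻¹) (ha₁ : |a₁ x| ≤ M * (1 + x ^ 2)⁻¹)
    (ha₃ : |a₃ x| ≤ M * (1 + x ^ 2)⁻¹) (hb : |b x| ≤ M * (1 + x ^ 2)⁻¹)
    (hb₁ : |b₁ x| ≤ M * (1 + x ^ 2)⁻¹) :
    |virialDensity f l μ a a₁ a₃ b b₁ x| ≤ 5 * M ^ 2 * (1 + x ^ 2)⁻¹ := by
  set m := M * (1 + x ^ 2)⁻¹ with hm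
  have hm0 : 0 ≤ m := (abs_nonneg _).trans ha
  have hprod : ∀ {u v : ℝ}, |u| ≤ m → |v| ≤ m → |u * v| ≤ m ^ 2 := by
    intro u v hu hv
    rw [abs_mul, pow_two]
    exact mul_le_mul hu hv (abs_nonneg _) hm0
  have hw : |sech (x / l) ^ 2 * (-(x / l) * μ)| ≤ 1 := by
    have h1 := abs_mul_sech_sq_le_one (x / l)
    rw [abs_mul, abs_mul, abs_neg, abs_of_nonneg (sq_nonneg (sech (x / l)))]
    calc _ = |x / l| * sech (x / l) ^ 2 * |μ| := by ring
      _ ≤ 1 * 1 := mul_le_mul h1 hμ (abs_nonneg _) zero_le_one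
      _ = 1 := one_mul 1
  have h1 : |sech (x / l) ^ 2 * (-(x / l) * μ) * (a x * b x)| ≤ m ^ 2 := by
    rw [abs_mul]
    exact (mul_le_of_le_one_left (abs_nonneg _) hw).trans (hprod ha hb)
  have h2 : |b₁ x * b x + a x * (a₁ x - a₃ x - deriv f (a x) * a₁ x)| ≤ 4 * m ^ 2 := by
    have e1 := abs_le.1 (hprod hb₁ hb)
    have e2 := abs_le.1 (hprod ha ha₁)
    have e3 := abs_le.1 (hprod ha ha₃)
    have e4 : |deriv f (a x) * (a x * a₁ x)| ≤ m ^ 2 := by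
      rw [abs_mul]
      exact (mul_le_of_le_one_left (abs_nonneg _) hf).trans (hprod ha ha₁)
    have e5 := abs_le.1 e4
    rw [abs_le]
    constructor <;> nlinarith
  have h3 : |Real.tanh (x / l) * (b₁ x * b x + a x * (a₁ x - a₃ x - deriv f (a x) * a₁ x))|
      ≤ 4 * m ^ 2 := by
    rw [abs_mul]
    exact (mul_le_of_le_one_left (abs_nonneg _) (abs_tanh_le_one _)).trans h2
  have h4 : m ^ 2 ≤ M ^ 2 * (1 + x ^ 2)⁻¹ := by
    have e1 := inv_one_add_sq_le_one x
    have e2 : 0 ≤ (1 + x ^ 2)⁻¹ := by positivity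
    rw [hm, mul_pow]
    exact mul_le_mul_of_nonneg_left (by nlinarith) (sq_nonneg M)
  calc |virialDensity f l μ a a₁ a₃ b b₁ x| ≤ m ^ 2 + 4 * m ^ 2 :=
        (abs_add_le _ _).trans (add_le_add h1 h3)
    _ ≤ 5 * M ^ 2 * (1 + x ^ 2)⁻¹ := by nlinarith

lemma continuous_virialDensity {f : ℝ → ℝ} (l μ : ℝ) {a a₁ a₃ b b₁ : ℝ → ℝ}
    (hf : ContDiff ℝ (⊤ : ℕ∞) f) (ha : Continuous a) (ha₁ : Continuous a₁) (ha₃ : Continuous a₃)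
    (hb : Continuous b) (hb₁ : Continuous b₁) :
    Continuous (virialDensity f l μ a a₁ a₃ b b₁) := by
  have hf' : Continuous (deriv f) := hf.continuous_deriv (by simp)
  have hx : Continuous fun x : ℝ => x / l := by fun_prop
  have hS : Continuous fun x : ℝ => sech (x / l) ^ 2 := continuous_sech_sq.comp hx
  have hT : Continuous fun x : ℝ => Real.tanh (x / l) := continuous_tanh.comp hx
  unfold virialDensity
  fun_prop

lemma integral_virialDensity_le {f : ℝ → ℝ} {l μ : ℝ} {a a₁ a₂ a₃ b b₁ : ℝ → ℝ}
    (hl : 0 < l) (hf : ContDiff ℝ (⊤ : ℕ∞) f)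
    (hfa : ∀ x r, |r| ≤ |a x| → |deriv f r| ≤ 1 / 4)
    (ha : ∀ x, HasDerivAt a (a₁ x) x) (ha₁ : ∀ x, HasDerivAt a₁ (a₂ x) x)
    (ha₂ : ∀ x, HasDerivAt a₂ (a₃ x) x) (hb : ∀ x, HasDerivAt b (b₁ x) x)
    (da : QuadDecay a) (da₁ : QuadDecay a₁) (da₂ : QuadDecay a₂) (da₃ : QuadDecay a₃)
    (db : QuadDecay b) (db₁ : QuadDecay b₁)
    (hea : ∫ x, (a x ^ 2 + a₁ x ^ 2) ≤ 1) (heb : ∫ x, b x ^ 2 ≤ 1) :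
    ∫ x, virialDensity f l μ a a₁ a₃ b b₁ x
      ≤ -(1 / (4 * l)) * (∫ x, sech (x / l) ^ 2 * (a x ^ 2 + a₁ x ^ 2 + b x ^ 2))
        + |μ| + 1 / l ^ 3 := by
  set G : ℝ → ℝ := fun s => ∫ r in (0 : ℝ)..s, r * deriv f r
  have hGd : ∀ s, HasDerivAt G (s * deriv f s) s := hasDerivAt_integral_mul_deriv hf
  have hGc : Continuous G := continuous_iff_continuousAt.2 fun s => (hGd s).continuousAt
  have hGb : ∀ x, |G (a x)| ≤ 1 / 4 * a x ^ 2 := fun x => abs_integral_mul_deriv_le (hfa x)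
  have hf' : Continuous (deriv f) := hf.continuous_deriv (by simp)
  have hx : Continuous fun x : ℝ => x / l := by fun_prop
  have hS : Continuous fun x : ℝ => sech (x / l) ^ 2 := continuous_sech_sq.comp hx
  have hT : Continuous fun x : ℝ => Real.tanh (x / l) := continuous_tanh.comp hx
  have hSb : ∀ x : ℝ, |sech (x / l) ^ 2| ≤ 1 := fun x => by
    rw [abs_of_nonneg (sq_nonneg _)]; exact sech_sq_le_one _
  have hTb : ∀ x : ℝ, |Real.tanh (x / l)| ≤ 1 := fun x => abs_tanh_le_one _
  have dG : QuadDecay fun x => G (a x) :=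
    (da.sq.const_mul (1 / 4)).of_le (hGc.comp da.1) fun x =>
      (hGb x).trans (le_abs_self _)
  have dfa : QuadDecay fun x => deriv f (a x) * a₁ x :=
    da₁.bdd_mul (hf'.comp da.1) fun x => hfa x _ le_rfl
  -- the flux `Q` collects the exact derivatives
  set Q : ℝ → ℝ := fun x =>
    Real.tanh (x / l) * ((1 / 2 * b x ^ 2 + 1 / 2 * a x ^ 2 - a x * a₂ x + 1 / 2 * a₁ x ^ 2)
      - G (a x)) + 1 / l * (sech (x / l) ^ 2 * (a x * a₁ x))
      + 1 / l ^ 2 * (Real.tanh (x / l) * (sech (x / l) ^ 2 * a x ^ 2))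
  set Q' : ℝ → ℝ := fun x =>
    Real.tanh (x / l) * (b x * b₁ x + a x * (a₁ x - a₃ x - deriv f (a x) * a₁ x))
      + 1 / l * (sech (x / l) ^ 2 * ((1 / 2 * b x ^ 2 + 1 / 2 * a x ^ 2 + 3 / 2 * a₁ x ^ 2)
        - G (a x)))
      + 1 / l ^ 3 * ((3 * (sech (x / l) ^ 2) ^ 2 - 2 * sech (x / l) ^ 2) * a x ^ 2) with hQ'
  have dQ : QuadDecay Q := by
    refine QuadDecay.add (QuadDecay.add ?_ ?_) ?_
    · refine QuadDecay.bdd_mul ?_ hT hTb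
      exact ((((db.sq.const_mul _).add (da.sq.const_mul _)).sub (da.mul da₂)).add
        (da₁.sq.const_mul _)).sub dG
    · exact ((da.mul da₁).bdd_mul hS hSb).const_mul _
    · exact ((da.sq.bdd_mul hS hSb).bdd_mul hT hTb).const_mul _
  have dQ' : QuadDecay Q' := by
    refine QuadDecay.add (QuadDecay.add ?_ ?_) ?_
    · refine QuadDecay.bdd_mul ?_ hT hTb
      exact (db.mul db₁).add (da.mul ((da₁.sub da₃).sub dfa))
    · refine ((QuadDecay.bdd_mul ?_ hS hSb)).const_mul _
      exact (((db.sq.const_mul _).add (da.sq.const_mul _)).add (da₁.sq.const_mul _)).sub dG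
    · refine (QuadDecay.bdd_mul da.sq (B := 5) (by fun_prop) fun x => ?_).const_mul _
      have h0 := sq_nonneg (sech (x / l))
      have h1 := sech_sq_le_one (x / l)
      rw [abs_le]
      constructor <;> nlinarith
  have hQd : ∀ x, HasDerivAt Q (Q' x) x := by
    intro x
    have hxl : HasDerivAt (fun x : ℝ => x / l) (1 / l) x := (hasDerivAt_id x).div_const l
    have hTd : HasDerivAt (fun x : ℝ => Real.tanh (x / l)) (sech (x / l) ^ 2 * (1 / l)) x :=
      HasDerivAt.comp (h₂ := Real.tanh) x (hasDerivAt_tanh (x / l)) hxl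
    have hSd : HasDerivAt (fun x : ℝ => sech (x / l) ^ 2)
        (-2 * Real.tanh (x / l) * sech (x / l) ^ 2 * (1 / l)) x :=
      HasDerivAt.comp (h₂ := fun y => sech y ^ 2) x (hasDerivAt_sech_sq (x / l)) hxl
    have hGa : HasDerivAt (fun x => G (a x)) (a x * deriv f (a x) * a₁ x) x :=
      (hGd (a x)).comp x (ha x)
    have hE := ((((((hb x).pow 2).const_mul (1 / 2)).add
      (((ha x).pow 2).const_mul (1 / 2))).sub ((ha x).mul (ha₂ x))).add
      (((ha₁ x).pow 2).const_mul (1 / 2))).sub hGa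
    have h := ((hTd.mul hE).add
      ((hSd.mul ((ha x).mul (ha₁ x))).const_mul (1 / l))).add
      ((hTd.mul (hSd.mul ((ha x).pow 2))).const_mul (1 / l ^ 2))
    refine h.congr_deriv ?_
    have ht := tanh_sq_eq (x / l)
    simp only [hQ', Pi.mul_apply, Pi.add_apply, Pi.sub_apply, Pi.pow_apply]
    set T := Real.tanh (x / l)
    set S := sech (x / l) ^ 2
    have : T * (-2 * T * S * (1 / l) * a x ^ 2) = -2 * (1 - S) * S * (1 / l) * a x ^ 2 := by
      rw [← ht]; ring
    push_cast
    linear_combination (-2 * S * a x ^ 2 / l ^ 3) * ht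
  have hQ0 : ∫ x, Q' x = 0 :=
    integral_eq_zero_of_hasDerivAt_of_integrable hQd dQ'.integrable dQ.integrable
  have hpt : ∀ x, virialDensity f l μ a a₁ a₃ b b₁ x ≤
      Q' x + (-(1 / (4 * l))) * (sech (x / l) ^ 2 * (a x ^ 2 + a₁ x ^ 2 + b x ^ 2))
        + |μ| / 2 * (a x ^ 2 + b x ^ 2) + 1 / l ^ 3 * a x ^ 2 := by
    intro x
    simp only [hQ', virialDensity]
    have hS0 := sq_nonneg (sech (x / l))
    have hG1 := (abs_le.1 (hGb x)).2
    have h1 : sech (x / l) ^ 2 * (-(x / l) * μ) * (a x * b x)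
        ≤ |μ| / 2 * (a x ^ 2 + b x ^ 2) := by
      have e1 := abs_mul_sech_sq_le_one (x / l)
      have e2 : |a x * b x| ≤ (a x ^ 2 + b x ^ 2) / 2 := by
        rw [abs_le]
        constructor <;> nlinarith [sq_nonneg (a x + b x), sq_nonneg (a x - b x)]
      refine (le_abs_self _).trans ?_
      rw [abs_mul, abs_mul, abs_mul, abs_neg, abs_of_nonneg hS0]
      calc _ = (|x / l| * sech (x / l) ^ 2) * (|μ| * |a x * b x|) := by ring
        _ ≤ 1 * (|μ| * ((a x ^ 2 + b x ^ 2) / 2)) := by gcongr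
        _ = _ := by ring
    set S := sech (x / l) ^ 2
    have h2 : 1 / l * (S * (1 / 4 * (a x ^ 2 + a₁ x ^ 2 + b x ^ 2))) ≤
        1 / l * (S * ((1 / 2 * b x ^ 2 + 1 / 2 * a x ^ 2 + 3 / 2 * a₁ x ^ 2) - G (a x))) := by
      have e : 1 / 4 * (a x ^ 2 + a₁ x ^ 2 + b x ^ 2) ≤
        (1 / 2 * b x ^ 2 + 1 / 2 * a x ^ 2 + 3 / 2 * a₁ x ^ 2) - G (a x) := by
        nlinarith [sq_nonneg (b x), sq_nonneg (a₁ x)]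
      gcongr
    have h3 : 0 ≤ 1 / l ^ 3 * ((3 * S ^ 2 - 2 * S + 1) * a x ^ 2) := by
      have : 0 ≤ 3 * S ^ 2 - 2 * S + 1 := by nlinarith [sq_nonneg (S - 1)]
      positivity
    have h4 : -(1 / (4 * l)) * (S * (a x ^ 2 + a₁ x ^ 2 + b x ^ 2)) =
        -(1 / l * (S * (1 / 4 * (a x ^ 2 + a₁ x ^ 2 + b x ^ 2)))) := by
      field_simp
    rw [h4]
    nlinarith
  have dab : QuadDecay fun x => a x ^ 2 + b x ^ 2 := da.sq.add db.sq
  have dW : QuadDecay fun x => sech (x / l) ^ 2 * (a x ^ 2 + a₁ x ^ 2 + b x ^ 2) :=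
    ((da.sq.add da₁.sq).add db.sq).bdd_mul hS hSb
  have dD : QuadDecay (virialDensity f l μ a a₁ a₃ b b₁) := by
    refine QuadDecay.add ?_ ?_
    · refine QuadDecay.bdd_mul (B := |μ|) (da.mul db) (by fun_prop) fun x => ?_
      rw [abs_mul, abs_mul, abs_neg, abs_of_nonneg (sq_nonneg (sech (x / l))), ← mul_assoc,
        mul_comm (sech (x / l) ^ 2)]
      exact mul_le_of_le_one_left (abs_nonneg _) (abs_mul_sech_sq_le_one _)
    · exact ((db₁.mul db).add (da.mul ((da₁.sub da₃).sub dfa))).bdd_mul hT hTb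
  have hint := integral_mono dD.integrable
    (((dQ'.add (dW.const_mul _)).add (dab.const_mul _)).add (da.sq.const_mul _)).integrable hpt
  rw [integral_add ((dQ'.add (dW.const_mul _)).add (dab.const_mul _)).integrable
      (da.sq.const_mul _).integrable,
    integral_add (dQ'.add (dW.const_mul _)).integrable (dab.const_mul _).integrable,
    integral_add dQ'.integrable (dW.const_mul _).integrable, hQ0, integral_const_mul,
    integral_const_mul, integral_const_mul,
    integral_add da.sq.integrable db.sq.integrable] at hint
  have hea' : ∫ x, a x ^ 2 ≤ 1 := by
    rw [integral_add da.sq.integrable da₁.sq.integrable] at hea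
    have : 0 ≤ ∫ x, a₁ x ^ 2 := integral_nonneg fun x => sq_nonneg _
    linarith
  have h5 : |μ| / 2 * ((∫ x, a x ^ 2) + ∫ x, b x ^ 2) ≤ |μ| / 2 * 2 := by
    gcongr; linarith
  have h6 : 1 / l ^ 3 * ∫ x, a x ^ 2 ≤ 1 / l ^ 3 * 1 := by gcongr
  linarith

/-! ### The scale and the time derivative of the virial functional -/

/-- The logarithmic derivative of `lam C`. -/
noncomputable def lamLogDeriv (t : ℝ) : ℝ := (1 - 2 / Real.log t) / t

lemma one_lt_log {t : ℝ} (ht : 3 ≤ t) : 1 < Real.log t := by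
  rw [Real.lt_log_iff_exp_lt (by linarith)]
  exact Real.exp_one_lt_d9.trans_le (by linarith)

lemma lam_pos {C t : ℝ} (hC : 0 < C) (ht : 3 ≤ t) : 0 < lam C t := by
  have h1 := one_lt_log ht
  have h2 : 0 < t := by linarith
  have h3 : 0 < Real.log t := by linarith
  unfold lam
  positivity

lemma hasDerivAt_lam (C : ℝ) {t : ℝ} (ht : 3 ≤ t) :
    HasDerivAt (lam C) (lam C t * lamLogDeriv t) t := by
  have h1 : Real.log t ≠ 0 := by linarith [one_lt_log ht]
  have h2 : t ≠ 0 := by linarith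
  have h := ((hasDerivAt_id t).const_mul C).div ((Real.hasDerivAt_log h2).pow 2)
    (pow_ne_zero 2 h1)
  refine h.congr_deriv ?_
  simp only [lam, lamLogDeriv, id, Pi.pow_apply]
  field_simp
  push_cast
  ring

lemma abs_lamLogDeriv_le {t : ℝ} (ht : 3 ≤ t) : |lamLogDeriv t| ≤ 1 / t := by
  have h1 := one_lt_log ht
  have h2 : 0 < t := by linarith
  have h3 : 0 < 2 / Real.log t := by positivity
  have h4 : 2 / Real.log t ≤ 2 := by
    rw [div_le_iff₀ (by linarith)]
    linarith
  rw [lamLogDeriv, abs_div, abs_of_pos h2]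
  gcongr
  rw [abs_le]
  constructor <;> linarith

lemma hasDerivAt_tanh_div_lam {C t : ℝ} (hC : 0 < C) (ht : 3 ≤ t) (x : ℝ) :
    HasDerivAt (fun s => Real.tanh (x / lam C s))
      (sech (x / lam C t) ^ 2 * (-(x / lam C t) * lamLogDeriv t)) t := by
  have hl := (lam_pos hC ht).ne'
  have h : HasDerivAt (fun s => x / lam C s) (-(x / lam C t) * lamLogDeriv t) t := by
    refine ((hasDerivAt_const t x).div (hasDerivAt_lam C ht) hl).congr_deriv ?_
    field_simp
    ring
  exact HasDerivAt.comp (h₂ := Real.tanh) t (hasDerivAt_tanh _) h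

lemma abs_le_of_weighted {y x M : ℝ} (h : (1 + |x|) ^ 2 * |y| ≤ M) :
    |y| ≤ M * (1 + x ^ 2)⁻¹ := by
  rw [← div_eq_mul_inv, le_div_iff₀ (by positivity)]
  have h1 : 1 + x ^ 2 ≤ (1 + |x|) ^ 2 := by nlinarith [abs_nonneg x, sq_abs x]
  nlinarith [abs_nonneg y]

lemma contDiff_slice {u : ℝ → ℝ → ℝ} (hu : ContDiff ℝ (⊤ : ℕ∞) fun q : ℝ × ℝ => u q.1 q.2)
    (t : ℝ) : ContDiff ℝ (⊤ : ℕ∞) (u t) :=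
  hu.comp (contDiff_const.prodMk contDiff_id : ContDiff ℝ (⊤ : ℕ∞) fun x : ℝ => (t, x))

lemma hasDerivAt_time {u : ℝ → ℝ → ℝ} (hu : ContDiff ℝ (⊤ : ℕ∞) fun q : ℝ × ℝ => u q.1 q.2)
    (t x : ℝ) : HasDerivAt (fun s => u s x) (deriv (fun s => u s x) t) t := by
  have h : ContDiff ℝ (⊤ : ℕ∞) fun s => u s x :=
    hu.comp (contDiff_id.prodMk contDiff_const : ContDiff ℝ (⊤ : ℕ∞) fun s : ℝ => (s, x))
  exact (h.differentiable (by simp) t).hasDerivAt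

lemma hasDerivAt_iteratedDeriv {g : ℝ → ℝ} (hg : ContDiff ℝ (⊤ : ℕ∞) g) (k : ℕ) (x : ℝ) :
    HasDerivAt (iteratedDeriv k g) (iteratedDeriv (k + 1) g x) x := by
  rw [iteratedDeriv_succ]
  exact (hg.differentiable_iteratedDeriv k (mod_cast WithTop.coe_lt_top _) x).hasDerivAt

lemma continuous_iteratedDeriv {g : ℝ → ℝ} (hg : ContDiff ℝ (⊤ : ℕ∞) g) (k : ℕ) :
    Continuous (iteratedDeriv k g) :=
  continuous_iff_continuousAt.2 fun x => (hasDerivAt_iteratedDeriv hg k x).continuousAt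

/-- The virial functional `∫ tanh (x / lam C t) * u₁ * u₂`. -/
noncomputable def virial (C : ℝ) (u₁ u₂ : ℝ → ℝ → ℝ) (t : ℝ) : ℝ :=
  ∫ x, Real.tanh (x / lam C t) * (u₁ t x * u₂ t x)

/-- Space derivatives decay like `(1 + x ^ 2)⁻¹`, locally uniformly in time. -/
def LocUnifDecay (u : ℝ → ℝ → ℝ) : Prop :=
  ∀ T : ℝ, ∀ k : ℕ, ∃ M : ℝ, ∀ t ∈ Set.Icc (-T) T, ∀ x : ℝ,
    |iteratedDeriv k (u t) x| ≤ M * (1 + x ^ 2)⁻¹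

lemma LocUnifDecay.quadDecay {u : ℝ → ℝ → ℝ} (h : LocUnifDecay u)
    (hu : ContDiff ℝ (⊤ : ℕ∞) fun q : ℝ × ℝ => u q.1 q.2) (t : ℝ) (k : ℕ) :
    QuadDecay (iteratedDeriv k (u t)) := by
  obtain ⟨M, hM⟩ := h |t| k
  exact ⟨continuous_iteratedDeriv (contDiff_slice hu t) k, M, hM t ⟨neg_abs_le t, le_abs_self t⟩⟩

lemma hasDerivAt_virial {C : ℝ} (hC : 0 < C) {f : ℝ → ℝ} {u₁ u₂ : ℝ → ℝ → ℝ}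
    (hf : ContDiff ℝ (⊤ : ℕ∞) f)
    (h₁ : ContDiff ℝ (⊤ : ℕ∞) (fun q : ℝ × ℝ => u₁ q.1 q.2))
    (h₂ : ContDiff ℝ (⊤ : ℕ∞) (fun q : ℝ × ℝ => u₂ q.1 q.2))
    (e₁ : ∀ t x : ℝ, deriv (fun s => u₁ s x) t = deriv (u₂ t) x)
    (e₂ : ∀ t x : ℝ, deriv (fun s => u₂ s x) t
      = deriv (fun y => u₁ t y - deriv (deriv (u₁ t)) y - f (u₁ t y)) x)
    (d₁ : LocUnifDecay u₁) (d₂ : LocUnifDecay u₂)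
    (hfu : ∀ t, 3 ≤ t → ∀ x, |deriv f (u₁ t x)| ≤ 1) {t : ℝ} (ht : 3 < t) :
    HasDerivAt (virial C u₁ u₂)
      (∫ x, virialDensity f (lam C t) (lamLogDeriv t) (u₁ t) (iteratedDeriv 1 (u₁ t))
        (iteratedDeriv 3 (u₁ t)) (u₂ t) (iteratedDeriv 1 (u₂ t)) x) t := by
  have e₂' : ∀ s x, deriv (fun s => u₂ s x) s = iteratedDeriv 1 (u₁ s) x
      - iteratedDeriv 3 (u₁ s) x - deriv f (u₁ s x) * iteratedDeriv 1 (u₁ s) x := by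
    intro s x
    rw [e₂]
    have g := contDiff_slice h₁ s
    have k0 := hasDerivAt_iteratedDeriv g 0 x
    have k2 := hasDerivAt_iteratedDeriv g 2 x
    have hdd : iteratedDeriv 2 (u₁ s) = deriv (deriv (u₁ s)) := by
      rw [iteratedDeriv_succ, iteratedDeriv_one]
    rw [iteratedDeriv_zero] at k0
    rw [hdd] at k2
    have kf : HasDerivAt f (deriv f (u₁ s x)) (u₁ s x) :=
      (hf.differentiable (by simp) _).hasDerivAt
    exact ((k0.sub k2).sub (HasDerivAt.comp (h₂ := f) x kf k0)).deriv
  obtain ⟨A0, hA0⟩ := d₁ (t + 1) 0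
  obtain ⟨A1, hA1⟩ := d₁ (t + 1) 1
  obtain ⟨A3, hA3⟩ := d₁ (t + 1) 3
  obtain ⟨B0, hB0⟩ := d₂ (t + 1) 0
  obtain ⟨B1, hB1⟩ := d₂ (t + 1) 1
  set M := max A0 (max A1 (max A3 (max B0 B1))) with hM
  have hmono : ∀ {A x : ℝ}, A ≤ M → A * (1 + x ^ 2)⁻¹ ≤ M * (1 + x ^ 2)⁻¹ := fun h => by
    gcongr
  have m1 : A0 ≤ M := by simp [hM]
  have m2 : A1 ≤ M := by simp [hM]
  have m3 : A3 ≤ M := by simp [hM]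
  have m4 : B0 ≤ M := by simp [hM]
  have m5 : B1 ≤ M := by simp [hM]
  have hcs : ∀ s, Continuous fun x => Real.tanh (x / lam C s) * (u₁ s x * u₂ s x) := fun s =>
    (continuous_tanh.comp (by fun_prop : Continuous fun x : ℝ => x / lam C s)).mul
      ((contDiff_slice h₁ s).continuous.mul (contDiff_slice h₂ s).continuous)
  have q0 := d₁.quadDecay h₁ t 0
  have r0 := d₂.quadDecay h₂ t 0
  rw [iteratedDeriv_zero] at q0 r0
  have hS : Set.Ioo 3 (t + 1) ∈ nhds t := Ioo_mem_nhds ht (by linarith)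
  refine (hasDerivAt_integral_of_dominated_loc_of_deriv_le
    (F' := fun s x => virialDensity f (lam C s) (lamLogDeriv s) (u₁ s) (iteratedDeriv 1 (u₁ s))
      (iteratedDeriv 3 (u₁ s)) (u₂ s) (iteratedDeriv 1 (u₂ s)) x)
    (bound := fun x => 5 * M ^ 2 * (1 + x ^ 2)⁻¹) hS ?_ ?_ ?_ ?_ ?_ ?_).2
  · exact Eventually.of_forall fun s => (hcs s).aestronglyMeasurable
  · exact ((q0.mul r0).bdd_mul (continuous_tanh.comp
      (by fun_prop : Continuous fun x : ℝ => x / lam C t))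
      fun x => abs_tanh_le_one _).integrable
  · exact (continuous_virialDensity _ _ hf q0.1 (d₁.quadDecay h₁ t 1).1
      (d₁.quadDecay h₁ t 3).1 r0.1 (d₂.quadDecay h₂ t 1).1).aestronglyMeasurable
  · refine Eventually.of_forall fun x s hs => ?_
    have hs' : s ∈ Set.Icc (-(t + 1)) (t + 1) := ⟨by linarith [hs.1], hs.2.le⟩
    have hμ : |lamLogDeriv s| ≤ 1 := by
      refine (abs_lamLogDeriv_le hs.1.le).trans ?_
      rw [div_le_one (by linarith [hs.1])]
      linarith [hs.1]
    refine abs_virialDensity_le hμ (hfu s hs.1.le x) ?_ ?_ ?_ ?_ ?_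
    · simpa using (hA0 s hs' x).trans (hmono m1)
    · exact (hA1 s hs' x).trans (hmono m2)
    · exact (hA3 s hs' x).trans (hmono m3)
    · simpa using (hB0 s hs' x).trans (hmono m4)
    · exact (hB1 s hs' x).trans (hmono m5)
  · exact integrable_inv_one_add_sq.const_mul _
  · refine Eventually.of_forall fun x s hs => ?_
    have k := (hasDerivAt_tanh_div_lam hC hs.1.le x).mul
      ((hasDerivAt_time h₁ s x).mul (hasDerivAt_time h₂ s x))
    refine k.congr_deriv ?_
    rw [e₁, e₂', ← iteratedDeriv_one]
    rfl

/-! ### From the virial inequality to a sequence of times -/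

lemma exists_deriv_gt_neg_inv {I I' : ℝ → ℝ} {B T : ℝ} (hT : 0 < T)
    (hI : ∀ t, T ≤ t → HasDerivAt I (I' t) t) (hB : ∀ t, T ≤ t → -B ≤ I t) :
    ∃ t, T ≤ t ∧ -(1 / t) < I' t := by
  by_contra! hcon
  have hder : ∀ t ∈ Set.Ici T, HasDerivAt (fun t => I t + Real.log t) (I' t + t⁻¹) t :=
    fun t ht => (hI t ht).add (Real.hasDerivAt_log (hT.trans_le ht).ne')
  have hanti : AntitoneOn (fun t => I t + Real.log t) (Set.Ici T) := by
    refine antitoneOn_of_deriv_nonpos (convex_Ici T)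
      (fun t ht => (hder t ht).continuousAt.continuousWithinAt) ?_ ?_
    · intro t ht
      exact (hder t (interior_subset ht)).differentiableAt.differentiableWithinAt
    · intro t ht
      rw [(hder t (interior_subset ht)).deriv]
      have := hcon t (interior_subset ht)
      rw [one_div] at this
      linarith
  obtain ⟨t, ht⟩ := ((Real.tendsto_log_atTop.eventually_gt_atTop (I T + Real.log T + B)).and
    (eventually_ge_atTop T)).exists
  have h1 : I t + Real.log t ≤ I T + Real.log T := hanti Set.self_mem_Ici ht.2 ht.2
  linarith [ht.1, hB t ht.2]

lemma eventually_virial_bound_le {C δ : ℝ} (hC : 0 < C) (hδ : 0 < δ) :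
    ∀ᶠ t in atTop, -(1 / (4 * lam C t)) * δ + 1 / t + 1 / lam C t ^ 3 ≤ -(1 / t) := by
  have h1 : Tendsto (fun t : ℝ => Real.log t ^ 6 / t ^ 2) atTop (nhds 0) := by
    have h : (fun t : ℝ => Real.log t ^ 3) =o[atTop] (fun t : ℝ => t) := by
      exact Real.isLittleO_pow_log_id_atTop (n := 3)
    have h' := (h.tendsto_div_nhds_zero).pow 2
    simpa [div_pow, ← pow_mul] using h'
  have h2 : ∀ᶠ t : ℝ in atTop, Real.log t ^ 6 / t ^ 2 < C ^ 3 :=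
    h1.eventually_lt_const (by positivity)
  have h3 : ∀ᶠ t : ℝ in atTop, 12 * C / δ ≤ Real.log t :=
    Real.tendsto_log_atTop.eventually_ge_atTop _
  filter_upwards [h2, h3, eventually_ge_atTop 3] with t h2 h3 h4
  have hL := one_lt_log h4
  have ht : 0 < t := by linarith
  have hL0 : 0 < Real.log t := by linarith
  have e1 : 1 / (4 * lam C t) * δ = δ * Real.log t ^ 2 / (4 * C) * (1 / t) := by
    unfold lam
    field_simp
  have e2 : 1 / lam C t ^ 3 = Real.log t ^ 6 / t ^ 2 / C ^ 3 * (1 / t) := by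
    unfold lam
    field_simp
  have e3 : Real.log t ^ 6 / t ^ 2 / C ^ 3 ≤ 1 := by
    rw [div_le_one (by positivity)]
    exact h2.le
  have e4 : 3 ≤ δ * Real.log t ^ 2 / (4 * C) := by
    rw [le_div_iff₀ (by positivity)]
    rw [div_le_iff₀ hδ] at h3
    nlinarith
  have e5 : 0 < 1 / t := by positivity
  rw [neg_mul, e1, e2]
  nlinarith

lemma exists_strictMono_tendsto {W : ℝ → ℝ} (hW : ∀ t, 0 ≤ W t)
    (h : ∀ δ > 0, ∀ T, ∃ t, T ≤ t ∧ W t < δ) :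
    ∃ τ : ℕ → ℝ, StrictMono τ ∧ Tendsto τ atTop atTop ∧
      Tendsto (fun n => W (τ n)) atTop (nhds 0) := by
  have h' : ∀ (n : ℕ) (T : ℝ), ∃ t, T ≤ t ∧ W t < 1 / ((n : ℝ) + 1) := fun n T =>
    h _ (by positivity) T
  choose g hg using h'
  let τ : ℕ → ℝ := fun n => Nat.rec (g 0 0) (fun n s => g (n + 1) (max (s + 1) (n + 1))) n
  have hτ : ∀ n, τ (n + 1) = g (n + 1) (max (τ n + 1) (n + 1)) := fun n => rfl
  have hmono : StrictMono τ := strictMono_nat_of_lt_succ fun n => by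
    have h1 := (hg (n + 1) (max (τ n + 1) (n + 1))).1
    rw [← hτ] at h1
    linarith [le_max_left (τ n + 1) ((n : ℝ) + 1)]
  have hge : ∀ n : ℕ, (n : ℝ) ≤ τ n := by
    rintro (_ | n)
    · exact_mod_cast (hg 0 0).1
    · rw [hτ]
      push_cast
      exact (le_max_right _ _).trans (hg (n + 1) _).1
  have hlt : ∀ n : ℕ, W (τ n) ≤ 1 / ((n : ℝ) + 1) := by
    rintro (_ | n)
    · exact (hg 0 0).2.le
    · rw [hτ]
      exact (hg (n + 1) _).2.le
  exact ⟨τ, hmono, tendsto_atTop_mono hge tendsto_natCast_atTop_atTop,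
    squeeze_zero (fun n => hW _) hlt tendsto_one_div_add_atTop_nhds_zero_nat⟩

lemma exists_small_deriv_bound {p K : ℝ} (hp : 1 < p) (hK : 0 < K) :
    ∃ ε₀ > (0 : ℝ), ε₀ ≤ 1 ∧ K * ε₀ ^ (p - 1) ≤ 1 / 4 := by
  have hp' : 0 < p - 1 := by linarith
  refine ⟨min 1 ((1 / (4 * K)) ^ (p - 1)⁻¹), by positivity, min_le_left _ _, ?_⟩
  calc K * (min 1 ((1 / (4 * K)) ^ (p - 1)⁻¹)) ^ (p - 1)
      ≤ K * ((1 / (4 * K)) ^ (p - 1)⁻¹) ^ (p - 1) := by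
        gcongr
        exact min_le_right _ _
    _ = 1 / 4 := by
        rw [Real.rpow_inv_rpow (by positivity) hp'.ne']
        field_simp

/-- Decay of the localized energy along a sequence of times \eqref{On_a_sequence}. -/
theorem stmt_7 (C p K : ℝ) (hC : 0 < C) (hp : 1 < p) (hK : 0 < K) :
    ∃ ε₀ > (0:ℝ),
    ∀ (f : ℝ → ℝ) (u₁ u₂ : ℝ → ℝ → ℝ),
      ContDiff ℝ (⊤ : ℕ∞) f → f 0 = 0 →
      (∀ s : ℝ, |s| ≤ 1 → |deriv f s| ≤ K * |s| ^ (p - 1)) →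
      ContDiff ℝ (⊤ : ℕ∞) (fun q : ℝ × ℝ => u₁ q.1 q.2) →
      ContDiff ℝ (⊤ : ℕ∞) (fun q : ℝ × ℝ => u₂ q.1 q.2) →
      (∀ t x : ℝ, deriv (fun s => u₁ s x) t = deriv (u₂ t) x) →
      (∀ t x : ℝ, deriv (fun s => u₂ s x) t
        = deriv (fun y => u₁ t y - deriv (deriv (u₁ t)) y - f (u₁ t y)) x) →
      (∀ T : ℝ, ∀ m k n : ℕ, ∃ M : ℝ, ∀ t ∈ Set.Icc (-T) T, ∀ x : ℝ,
        (1 + |x|) ^ n * |iteratedDeriv k (fun y => iteratedDeriv m (fun s => u₁ s y) t) x| ≤ M) →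
      (∀ T : ℝ, ∀ m k n : ℕ, ∃ M : ℝ, ∀ t ∈ Set.Icc (-T) T, ∀ x : ℝ,
        (1 + |x|) ^ n * |iteratedDeriv k (fun y => iteratedDeriv m (fun s => u₂ s y) t) x| ≤ M) →
      ∀ ε : ℝ, 0 < ε → ε ≤ ε₀ →
      (∀ t : ℝ, 2 ≤ t →
        Real.sqrt (∫ x : ℝ, ((u₁ t x) ^ 2 + (deriv (u₁ t) x) ^ 2))
          + Real.sqrt (∫ x : ℝ, (u₂ t x) ^ 2) + (⨆ x : ℝ, |u₁ t x|) ≤ ε) →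
      ∃ tseq : ℕ → ℝ, StrictMono tseq ∧ Tendsto tseq atTop atTop ∧
        Tendsto (fun n => ∫ x : ℝ, sech (x / lam C (tseq n)) ^ 2 *
            ((u₁ (tseq n) x) ^ 2 + (deriv (u₁ (tseq n)) x) ^ 2 + (u₂ (tseq n) x) ^ 2))
          atTop (nhds 0) := by
  obtain ⟨ε₀, hε₀, hε₀1, hKε⟩ := exists_small_deriv_bound hp hK
  refine ⟨ε₀, hε₀, ?_⟩
  intro f u₁ u₂ hf _ hfb h₁ h₂ e₁ e₂ D₁ D₂ ε _ hεε₀ hsmall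
  have d₁ : LocUnifDecay u₁ := fun T k => by
    obtain ⟨M, hM⟩ := D₁ T 0 k 2
    exact ⟨M, fun t ht x => abs_le_of_weighted (by simpa using hM t ht x)⟩
  have d₂ : LocUnifDecay u₂ := fun T k => by
    obtain ⟨M, hM⟩ := D₂ T 0 k 2
    exact ⟨M, fun t ht x => abs_le_of_weighted (by simpa using hM t ht x)⟩
  have q0 : ∀ t, QuadDecay (u₁ t) := fun t => by simpa using d₁.quadDecay h₁ t 0
  have r0 : ∀ t, QuadDecay (u₂ t) := fun t => by simpa using d₂.quadDecay h₂ t 0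
  have hbounds : ∀ t, 2 ≤ t → (∫ x, (u₁ t x ^ 2 + iteratedDeriv 1 (u₁ t) x ^ 2) ≤ 1) ∧
      (∫ x, u₂ t x ^ 2 ≤ 1) ∧ ∀ x, |u₁ t x| ≤ ε₀ := by
    intro t ht
    have hs := hsmall t ht
    have n1 := Real.sqrt_nonneg (∫ x : ℝ, ((u₁ t x) ^ 2 + (deriv (u₁ t) x) ^ 2))
    have n2 := Real.sqrt_nonneg (∫ x : ℝ, (u₂ t x) ^ 2)
    have n3 : 0 ≤ ⨆ x : ℝ, |u₁ t x| := Real.iSup_nonneg fun x => abs_nonneg _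
    refine ⟨?_, ?_, fun x => ?_⟩
    · rw [iteratedDeriv_one]
      exact Real.sqrt_le_one.1 (by linarith)
    · exact Real.sqrt_le_one.1 (by linarith)
    · obtain ⟨B, hB⟩ := (q0 t).bounded
      have : |u₁ t x| ≤ ⨆ x : ℝ, |u₁ t x| :=
        le_ciSup (f := fun x => |u₁ t x|) ⟨B, by rintro _ ⟨y, rfl⟩; exact hB y⟩ x
      linarith
  have hfq : ∀ r, |r| ≤ ε₀ → |deriv f r| ≤ 1 / 4 := fun r hr =>
    (hfb r (hr.trans hε₀1)).trans <| le_trans (by gcongr) hKε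
  have hder : ∀ t, 3 < t → HasDerivAt (virial C u₁ u₂) _ t := fun t ht =>
    hasDerivAt_virial hC hf h₁ h₂ e₁ e₂ d₁ d₂
      (fun t ht x => (hfq _ ((hbounds t (by linarith)).2.2 x)).trans (by norm_num)) ht
  have hlow : ∀ t, 3 < t → -1 ≤ virial C u₁ u₂ t := by
    intro t ht
    obtain ⟨b1, b2, -⟩ := hbounds t (by linarith)
    have q1 := d₁.quadDecay h₁ t 1
    have dA := ((q0 t).sq.add q1.sq).const_mul (-(1 / 2))
    have dB := (r0 t).sq.const_mul (-(1 / 2))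
    have dV : QuadDecay fun x => Real.tanh (x / lam C t) * (u₁ t x * u₂ t x) :=
      ((q0 t).mul (r0 t)).bdd_mul (continuous_tanh.comp
        (by fun_prop : Continuous fun x : ℝ => x / lam C t)) fun x => abs_tanh_le_one _
    have hle := integral_mono (dA.add dB).integrable dV.integrable fun x => by
      have h := abs_mul (Real.tanh (x / lam C t)) (u₁ t x * u₂ t x)
      have h' := mul_le_of_le_one_left (abs_nonneg (u₁ t x * u₂ t x))
        (abs_tanh_le_one (x / lam C t))
      have h'' : |u₁ t x * u₂ t x| ≤ 1 / 2 * (u₁ t x ^ 2 + u₂ t x ^ 2) := by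
        rw [abs_le]
        constructor <;> nlinarith [sq_nonneg (u₁ t x + u₂ t x), sq_nonneg (u₁ t x - u₂ t x)]
      have := neg_abs_le (Real.tanh (x / lam C t) * (u₁ t x * u₂ t x))
      have := sq_nonneg (iteratedDeriv 1 (u₁ t) x)
      linarith
    rw [integral_add dA.integrable dB.integrable, integral_const_mul, integral_const_mul] at hle
    unfold virial
    linarith
  refine exists_strictMono_tendsto
    (W := fun t => ∫ x : ℝ, sech (x / lam C t) ^ 2 *
      ((u₁ t x) ^ 2 + (deriv (u₁ t) x) ^ 2 + (u₂ t x) ^ 2))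
    (fun t => integral_nonneg fun x => by positivity) ?_
  intro δ hδ T
  by_contra! hcon
  obtain ⟨T₀, hT₀⟩ := eventually_atTop.1 (eventually_virial_bound_le hC hδ)
  obtain ⟨t, ht, hlt⟩ := exists_deriv_gt_neg_inv (T := max (max T T₀) 4)
    (lt_max_of_lt_right (by norm_num))
    (fun t ht => hder t (by linarith [(le_max_right _ _).trans ht]))
    (fun t ht => hlow t (by linarith [(le_max_right _ _).trans ht]))
  simp only [max_le_iff] at ht
  obtain ⟨⟨htT, htT₀⟩, ht4⟩ := ht
  obtain ⟨b1, b2, b3⟩ := hbounds t (by linarith)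
  have g₁ := contDiff_slice h₁ t
  have g₂ := contDiff_slice h₂ t
  have hl := lam_pos hC (by linarith : 3 ≤ t)
  have key := integral_virialDensity_le (μ := lamLogDeriv t) hl hf
    (fun x r hr => hfq r (hr.trans (b3 x)))
    (by simpa using hasDerivAt_iteratedDeriv g₁ 0) (hasDerivAt_iteratedDeriv g₁ 1)
    (hasDerivAt_iteratedDeriv g₁ 2) (by simpa using hasDerivAt_iteratedDeriv g₂ 0)
    (q0 t) (d₁.quadDecay h₁ t 1) (d₁.quadDecay h₁ t 2) (d₁.quadDecay h₁ t 3)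
    (r0 t) (d₂.quadDecay h₂ t 1) b1 b2
  have hW := hcon t htT
  rw [← iteratedDeriv_one] at hW
  have h5 : 1 / (4 * lam C t) * δ ≤ 1 / (4 * lam C t) * ∫ x : ℝ, sech (x / lam C t) ^ 2 *
      ((u₁ t x) ^ 2 + (iteratedDeriv 1 (u₁ t) x) ^ 2 + (u₂ t x) ^ 2) := by gcongr
  have h6 := abs_lamLogDeriv_le (by linarith : 3 ≤ t)
  have h7 := hT₀ t htT₀
  linarith
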